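/- In the setting of the previous statement, P* = Ψ Jᵀ U_s Q (for any invertible s×s matrix Q) minimizes ‖Σ_P − Σ‖_F over all p×s full-rank matrices P, where Σ_P = J P (Pᵀ Ψ⁻¹ P)⁻¹ Pᵀ Jᵀ and ‖·‖_F is the Frobenius norm. -/

import Mathlib

open Matrix

/-- Frobenius norm of a real matrix. -/
noncomputable def frobNorm {m n : ℕ} (A : Matrix (Fin m) (Fin n) ℝ) : ℝ :=
  Real.sqrt (∑ i, ∑ j, (A i j) ^ 2)

lemma frob_eq {m n : ℕ} (A : Matrix (Fin m) (Fin n) ℝ) :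
    frobNorm A = Real.sqrt (trace (Aᵀ * A)) := by
  unfold frobNorm
  congr 1
  rw [Finset.sum_comm]
  simp [trace, Matrix.mul_apply, sq]

lemma trace_nonneg_aux {m n : ℕ} (A : Matrix (Fin m) (Fin n) ℝ) : 0 ≤ trace (Aᵀ * A) := by
  simp only [trace, Matrix.mul_apply, diag_apply, transpose_apply]
  exact Finset.sum_nonneg fun i _ => Finset.sum_nonneg fun j _ => mul_self_nonneg _

/-- Orthogonal projection onto the column space. -/
lemma exists_proj {n s : ℕ} (A : Matrix (Fin n) (Fin s) ℝ) :
    ∃ K : Matrix (Fin n) (Fin n) ℝ, Kᵀ = K ∧ K * K = K ∧ K * A = A ∧ trace K ≤ s := by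
  have hH : (A * Aᵀ).IsHermitian := by
    simpa using isHermitian_mul_conjTranspose_self A
  obtain ⟨V, e, hV, hV', hS, hc⟩ : ∃ (V : Matrix (Fin n) (Fin n) ℝ) (e : Fin n → ℝ),
      Vᵀ * V = 1 ∧ V * Vᵀ = 1 ∧ A * Aᵀ = V * diagonal e * Vᵀ ∧
      (A * Aᵀ).rank = Fintype.card {i // e i ≠ 0} := by
    refine ⟨hH.eigenvectorUnitary, hH.eigenvalues, ?_, ?_, ?_, hH.rank_eq_card_non_zero_eigs⟩
    · simpa [star_eq_conjTranspose] using Unitary.coe_star_mul_self hH.eigenvectorUnitary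
    · simpa [star_eq_conjTranspose] using Unitary.coe_mul_star_self hH.eigenvectorUnitary
    · have := hH.spectral_theorem
      simpa [star_eq_conjTranspose, Unitary.conjStarAlgAut_apply, Function.comp_def] using this
  have hr : (A * Aᵀ).rank ≤ s := (rank_mul_le_left _ _).trans (by simpa using A.rank_le_width)
  set z : Fin n → ℝ := fun i => if e i ≠ 0 then 1 else 0 with hz
  have hze : diagonal z * diagonal e = diagonal e := by
    rw [diagonal_mul_diagonal]; congr 1; ext i; by_cases h : e i = 0 <;> simp [hz, h]
  have hzz : diagonal z * diagonal z = diagonal z := by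
    rw [diagonal_mul_diagonal]; congr 1; ext i; by_cases h : e i = 0 <;> simp [hz, h]
  have hK : (V * diagonal z * Vᵀ) * (A * Aᵀ) = A * Aᵀ := by
    rw [hS]
    calc _ = V * diagonal z * (Vᵀ * V) * diagonal e * Vᵀ := by simp only [Matrix.mul_assoc]
      _ = V * (diagonal z * diagonal e) * Vᵀ := by rw [hV]; simp [Matrix.mul_assoc]
      _ = _ := by rw [hze]
  refine ⟨V * diagonal z * Vᵀ, ?_, ?_, ?_, ?_⟩
  · simp [Matrix.mul_assoc]
  · calc _ = V * diagonal z * (Vᵀ * V) * diagonal z * Vᵀ := by simp only [Matrix.mul_assoc]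
      _ = V * (diagonal z * diagonal z) * Vᵀ := by rw [hV]; simp [Matrix.mul_assoc]
      _ = _ := by rw [hzz]
  · generalize V * diagonal z * Vᵀ = K at hK
    have h0 : (K * A - A) * (K * A - A)ᴴ = 0 := by
      have : (K * A - A) * (K * A - A)ᴴ
          = (K * (A * Aᵀ)) * Kᵀ - A * Aᵀ * Kᵀ - (K * (A * Aᵀ) - A * Aᵀ) := by
        simp [Matrix.sub_mul, Matrix.mul_sub, Matrix.mul_assoc]
      rw [this, hK]; simp
    exact sub_eq_zero.1 (self_mul_conjTranspose_eq_zero.1 h0)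
  · rw [Matrix.trace_mul_comm, ← Matrix.mul_assoc, hV, Matrix.one_mul, trace_diagonal]
    rw [hc, Fintype.card_subtype] at hr
    simp only [hz, Finset.sum_boole]
    exact_mod_cast hr

lemma kyfan {n s : ℕ} (c k : Fin n → ℝ) (hs : s ≤ n) (hc : ∀ i j, i ≤ j → c j ≤ c i)
    (hc0 : ∀ i, 0 ≤ c i) (hk0 : ∀ i, 0 ≤ k i) (hk1 : ∀ i, k i ≤ 1) (hk : ∑ i, k i ≤ s) :
    ∑ i, k i * c i ≤ ∑ i : Fin n, if (i : ℕ) < s then c i else 0 := by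
  obtain ⟨t, ht0, ht1, ht2⟩ : ∃ t : ℝ, 0 ≤ t ∧ (∀ i : Fin n, (i : ℕ) < s → t ≤ c i) ∧
      (∀ i : Fin n, ¬ (i : ℕ) < s → c i ≤ t) := by
    by_cases h : s < n
    · refine ⟨c ⟨s, h⟩, hc0 _, fun i hi => hc _ _ ?_, fun i hi => hc _ _ ?_⟩
      · rw [Fin.le_def]; simp; omega
      · rw [Fin.le_def]; simp; omega
    · exact ⟨0, le_rfl, fun i _ => hc0 i, fun i hi => absurd i.2 (by omega)⟩
  have hcount : ∑ i : Fin n, (if (i : ℕ) < s then (1:ℝ) else 0) = s := by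
    rw [Finset.sum_boole, Fin.card_filter_val_lt, min_eq_right hs]
  have h1 : ∑ i, k i * c i - ∑ i : Fin n, (if (i : ℕ) < s then c i else 0)
      ≤ ∑ i, (k i - if (i : ℕ) < s then (1:ℝ) else 0) * t := by
    rw [← Finset.sum_sub_distrib]
    refine Finset.sum_le_sum fun i _ => ?_
    by_cases h : (i : ℕ) < s
    · simp only [h, if_true]; nlinarith [ht1 i h, hk1 i]
    · simp only [h, if_false]; nlinarith [ht2 i h, hk0 i]
  rw [← Finset.sum_mul, Finset.sum_sub_distrib, hcount] at h1
  nlinarith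

/-- Eckart–Young lower bound in the eigenbasis. -/
lemma eckart {n s : ℕ} (d : Fin n → ℝ) (hs : s ≤ n) (hd : ∀ i j, i ≤ j → d j ≤ d i)
    (hd0 : ∀ i, 0 ≤ d i) (A : Matrix (Fin n) (Fin s) ℝ) (C : Matrix (Fin s) (Fin n) ℝ) :
    ∑ i : Fin n, (if (i : ℕ) < s then 0 else d i ^ 2)
      ≤ trace ((A * C - diagonal d)ᵀ * (A * C - diagonal d)) := by
  obtain ⟨L, hLt, hLL, hLA, hLs⟩ := exists_proj A
  set N := A * C - diagonal d with hN
  have e1 : trace (Nᵀ * N) = trace ((L * N)ᵀ * (L * N)) + trace (((1 - L) * N)ᵀ * ((1 - L) * N)) := by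
    rw [← trace_add]
    congr 1
    have h1 : (L * N)ᵀ * (L * N) = Nᵀ * (L * L) * N := by
      rw [transpose_mul, hLt]; simp only [Matrix.mul_assoc]
    have h2 : ((1 - L) * N)ᵀ * ((1 - L) * N) = Nᵀ * (1 - L - L + L * L) * N := by
      rw [transpose_mul, transpose_sub 1 L, hLt, transpose_one]
      noncomm_ring
    rw [h1, h2, hLL]
    noncomm_ring
  have e2 : (1 - L) * N = -((1 - L) * diagonal d) := by
    rw [hN, Matrix.mul_sub, ← Matrix.mul_assoc, Matrix.sub_mul, hLA]; simp
  have e3 : ((1 - L) * N)ᵀ * ((1 - L) * N) = diagonal d * (1 - L) * diagonal d := by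
    rw [e2, transpose_neg, neg_mul_neg, transpose_mul, transpose_sub, hLt, transpose_one,
      diagonal_transpose]
    have : (1 - L) * (1 - L) = 1 - L := by
      simp [Matrix.sub_mul, Matrix.mul_sub, hLL]
    calc _ = diagonal d * ((1 - L) * (1 - L)) * diagonal d := by simp only [Matrix.mul_assoc]
      _ = _ := by rw [this]
  have e4 : trace (diagonal d * (1 - L) * diagonal d) = ∑ i, d i ^ 2 - ∑ i, L i i * d i ^ 2 := by
    rw [← Finset.sum_sub_distrib]
    refine Finset.sum_congr rfl fun i _ => ?_
    simp [diagonal_mul, mul_diagonal]; ring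
  have hii : ∀ i, L i i = ∑ j, L i j ^ 2 := fun i => by
    conv_lhs => rw [← hLL, Matrix.mul_apply]
    refine Finset.sum_congr rfl fun j _ => ?_
    rw [sq]; congr 1; conv_lhs => rw [← hLt, transpose_apply]
  have hk0 : ∀ i, 0 ≤ L i i := fun i => by
    rw [hii]; exact Finset.sum_nonneg fun j _ => sq_nonneg _
  have hk1 : ∀ i, L i i ≤ 1 := fun i => by
    have : L i i ^ 2 ≤ L i i := by
      conv_rhs => rw [hii]
      exact Finset.single_le_sum (f := fun j => L i j ^ 2) (fun j _ => sq_nonneg _)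
        (Finset.mem_univ i)
    nlinarith [hk0 i]
  have hkf := kyfan (fun i => d i ^ 2) (fun i => L i i) hs
    (fun i j h => pow_le_pow_left₀ (hd0 j) (hd i j h) 2) (fun i => sq_nonneg _) hk0 hk1 hLs
  have e5 : ∑ i : Fin n, (if (i : ℕ) < s then 0 else d i ^ 2)
      = ∑ i, d i ^ 2 - ∑ i : Fin n, (if (i : ℕ) < s then d i ^ 2 else 0) := by
    rw [← Finset.sum_sub_distrib]
    refine Finset.sum_congr rfl fun i _ => ?_
    split_ifs <;> simp
  have := trace_nonneg_aux (L * N)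
  rw [e1, e3, e4, e5]
  linarith

lemma trace_conj {n : ℕ} (U M : Matrix (Fin n) (Fin n) ℝ) (h : Uᵀ * U = 1) :
    trace ((U * M * Uᵀ)ᵀ * (U * M * Uᵀ)) = trace (Mᵀ * M) := by
  have : (U * M * Uᵀ)ᵀ * (U * M * Uᵀ) = U * (Mᵀ * (Uᵀ * U) * M * Uᵀ) := by
    simp [Matrix.mul_assoc]
  rw [this, h, trace_mul_comm]
  simp only [Matrix.mul_assoc, h, Matrix.mul_one]

theorem optimal_subspace_minimizes_frobenius
    {p s nC : ℕ} (hnCp : nC ≤ p) (hs : s ≤ nC)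
    (Ψ : Matrix (Fin p) (Fin p) ℝ) (hΨ : Ψ.PosDef)
    (J : Matrix (Fin nC) (Fin p) ℝ) (hJ : J.rank = nC)
    (U : Matrix (Fin nC) (Fin nC) ℝ) (d : Fin nC → ℝ)
    (hU : Uᵀ * U = 1 ∧ U * Uᵀ = 1)
    (hd : ∀ i j : Fin nC, i ≤ j → d j ≤ d i)
    (hSpec : J * Ψ * Jᵀ = U * Matrix.diagonal d * Uᵀ)
    (Q : Matrix (Fin s) (Fin s) ℝ) (hQ : IsUnit Q) :
    ∀ P : Matrix (Fin p) (Fin s) ℝ, P.rank = s →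
      frobNorm (J * (Ψ * Jᵀ * U.submatrix id (Fin.castLE hs) * Q) *
          ((Ψ * Jᵀ * U.submatrix id (Fin.castLE hs) * Q)ᵀ * Ψ⁻¹ *
            (Ψ * Jᵀ * U.submatrix id (Fin.castLE hs) * Q))⁻¹ *
          (Ψ * Jᵀ * U.submatrix id (Fin.castLE hs) * Q)ᵀ * Jᵀ - J * Ψ * Jᵀ)
        ≤ frobNorm (J * P * (Pᵀ * Ψ⁻¹ * P)⁻¹ * Pᵀ * Jᵀ - J * Ψ * Jᵀ) := by

  intro P _
  obtain ⟨hU1, hU2⟩ := hU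
  have hΨt : Ψᵀ = Ψ := by simpa using hΨ.isHermitian.eq
  have hΨu : IsUnit Ψ.det := hΨ.det_pos.ne'.isUnit
  have hdiag : diagonal d = (Uᵀ * J) * Ψ * (Uᵀ * J)ᴴ := by
    calc diagonal d = (Uᵀ * U) * diagonal d * (Uᵀ * U) := by simp [hU1]
      _ = Uᵀ * (U * diagonal d * Uᵀ) * U := by simp only [Matrix.mul_assoc]
      _ = _ := by rw [← hSpec]; simp [Matrix.mul_assoc]
  have hd0 : ∀ i, 0 < d i := by
    have hJu : LinearIndependent ℝ J.row := by
      rw [linearIndependent_iff_card_eq_finrank_span, Set.finrank, ← rank_eq_finrank_span_row, hJ]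
      simp
    have hJinj : Function.Injective J.vecMul := vecMul_injective_iff.2 hJu
    have hpd : (diagonal d).PosDef := by
      rw [hdiag]
      refine hΨ.mul_mul_conjTranspose_same ?_
      intro x y hxy
      simp only [← vecMul_vecMul] at hxy
      have h2 := congrArg (fun v => v ᵥ* U) (hJinj hxy)
      simpa [vecMul_vecMul, hU1] using h2
    exact fun i => by simpa using hpd.diag_pos (i := i)
  rw [frob_eq, frob_eq]
  apply Real.sqrt_le_sqrt
  -- lower bound
  have hlow := eckart d hs hd (fun i => (hd0 i).le) (Uᵀ * (J * P))
    ((Pᵀ * Ψ⁻¹ * P)⁻¹ * Pᵀ * Jᵀ * U)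
  have hB : J * P * (Pᵀ * Ψ⁻¹ * P)⁻¹ * Pᵀ * Jᵀ - J * Ψ * Jᵀ =
      U * ((Uᵀ * (J * P)) * ((Pᵀ * Ψ⁻¹ * P)⁻¹ * Pᵀ * Jᵀ * U) - diagonal d) * Uᵀ := by
    rw [hSpec, Matrix.mul_sub, Matrix.sub_mul]
    congr 1
    calc _ = (U * Uᵀ) * (J * P * (Pᵀ * Ψ⁻¹ * P)⁻¹ * Pᵀ * Jᵀ) * (U * Uᵀ) := by
          rw [hU2, Matrix.one_mul, Matrix.mul_one]
      _ = _ := by simp only [Matrix.mul_assoc]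
  rw [hB, trace_conj _ _ hU1]
  refine le_trans (le_of_eq ?_) hlow
  -- the optimum
  set E : Matrix (Fin nC) (Fin s) ℝ := (1 : Matrix (Fin nC) (Fin nC) ℝ).submatrix id (Fin.castLE hs)
    with hE
  have hUs : U.submatrix id (Fin.castLE hs) = U * E := by
    ext i j
    simp [hE, Matrix.mul_apply, Matrix.one_apply]
  rw [hUs]
  set ds : Fin s → ℝ := fun i => d (Fin.castLE hs i) with hds
  have hDE : diagonal d * E = E * diagonal ds := by
    ext i j
    simp only [diagonal_mul, mul_diagonal, hE, submatrix_apply, id, Matrix.one_apply, hds]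
    split_ifs with h <;> simp [h]
  have hEE : Eᵀ * E = 1 := by
    ext i j
    simp [hE, Matrix.mul_apply, Matrix.one_apply, eq_comm]
  have hDEt : Eᵀ * diagonal d = diagonal ds * Eᵀ := by
    simpa using congrArg transpose hDE
  have hJP : J * (Ψ * Jᵀ * (U * E) * Q) = U * E * diagonal ds * Q := by
    calc _ = (J * Ψ * Jᵀ) * U * E * Q := by simp only [Matrix.mul_assoc]
      _ = U * diagonal d * (Uᵀ * U) * E * Q := by rw [hSpec]; simp only [Matrix.mul_assoc]
      _ = U * (diagonal d * E) * Q := by rw [hU1]; simp [Matrix.mul_assoc]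
      _ = _ := by rw [hDE]; simp only [Matrix.mul_assoc]
  have hPJ : (Ψ * Jᵀ * (U * E) * Q)ᵀ * Jᵀ = Qᵀ * diagonal ds * Eᵀ * Uᵀ := by
    rw [← transpose_mul, hJP]; simp [Matrix.mul_assoc]
  have hG : (Ψ * Jᵀ * (U * E) * Q)ᵀ * Ψ⁻¹ * (Ψ * Jᵀ * (U * E) * Q) = Qᵀ * diagonal ds * Q := by
    calc _ = (Ψ * Jᵀ * (U * E) * Q)ᵀ * (Ψ⁻¹ * Ψ) * Jᵀ * (U * E) * Q := by
          simp only [Matrix.mul_assoc]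
      _ = ((Ψ * Jᵀ * (U * E) * Q)ᵀ * Jᵀ) * (U * E) * Q := by
          rw [nonsing_inv_mul _ hΨu, Matrix.mul_one]
      _ = Qᵀ * diagonal ds * (Eᵀ * (Uᵀ * U) * E) * Q := by
          rw [hPJ]; simp only [Matrix.mul_assoc]
      _ = _ := by rw [hU1, Matrix.mul_one, hEE, Matrix.mul_one]
  have hQd : IsUnit Q.det := (isUnit_iff_isUnit_det Q).1 hQ
  have hQtd : IsUnit Qᵀ.det := by rwa [det_transpose]
  have hDd : IsUnit (diagonal ds).det := by
    rw [det_diagonal]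
    exact (Finset.prod_pos fun i _ => hd0 _).ne'.isUnit
  have hSig : J * (Ψ * Jᵀ * (U * E) * Q) *
      ((Ψ * Jᵀ * (U * E) * Q)ᵀ * Ψ⁻¹ * (Ψ * Jᵀ * (U * E) * Q))⁻¹ *
      (Ψ * Jᵀ * (U * E) * Q)ᵀ * Jᵀ = U * (E * diagonal ds * Eᵀ) * Uᵀ := by
    rw [Matrix.mul_assoc _ _ Jᵀ, hPJ, hG, hJP, Matrix.mul_inv_rev, Matrix.mul_inv_rev]
    calc _ = U * E * diagonal ds * (Q * Q⁻¹) * (diagonal ds)⁻¹ * ((Qᵀ)⁻¹ * Qᵀ) * diagonal ds * Eᵀ * Uᵀ := by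
          simp only [Matrix.mul_assoc]
      _ = U * E * (diagonal ds * (diagonal ds)⁻¹) * diagonal ds * Eᵀ * Uᵀ := by
          rw [mul_nonsing_inv _ hQd, nonsing_inv_mul _ hQtd]; simp only [Matrix.mul_assoc, Matrix.mul_one, Matrix.one_mul]
      _ = _ := by
          rw [mul_nonsing_inv _ hDd]; simp only [Matrix.mul_assoc, Matrix.one_mul]
  have hEd : E * diagonal ds * Eᵀ - diagonal d
      = diagonal (fun i : Fin nC => if (i : ℕ) < s then 0 else - d i) := by
    rw [← hDE, Matrix.mul_assoc]
    have : E * Eᵀ = diagonal (fun i : Fin nC => if (i : ℕ) < s then (1:ℝ) else 0) := by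
      ext i j
      simp only [hE, Matrix.mul_apply, submatrix_apply, transpose_apply, id, Matrix.one_apply,
        diagonal_apply]
      by_cases hi : (i : ℕ) < s
      · rw [Finset.sum_eq_single ⟨i, hi⟩]
        · have h1 : Fin.castLE hs ⟨i, hi⟩ = i := rfl
          simp [h1, hi, eq_comm]
        · intro b _ hb
          have h1 : i ≠ Fin.castLE hs b := fun h => hb (by ext; simp [h])
          simp [h1]
        · simp
      · rw [Finset.sum_eq_zero]
        · simp [hi]
        · intro b _
          have h1 : i ≠ Fin.castLE hs b := fun h => hi (by simp [h])
          simp [h1]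
    rw [this, diagonal_mul_diagonal, diagonal_sub]
    congr 1
    ext i
    split_ifs <;> simp
  rw [hSig, hSpec, ← Matrix.sub_mul, ← Matrix.mul_sub, trace_conj _ _ hU1, hEd, diagonal_transpose,
    diagonal_mul_diagonal, trace_diagonal]
  refine Finset.sum_congr rfl fun i _ => ?_
  split_ifs <;> simp [sq]
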